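/- Let (x*,λ*) be a saddle point of L, assume β(t) = μ e^{t/δ} with μ > 0 and γδ > 1, and let (x,λ) be a global solution of the primal-dual dynamical system. Then there exists C ≥ 0 such that ‖Ax(t) − b‖ ≤ C e^{−t/δ} for all t ≥ t₀. -/

import Mathlib

open scoped RealInnerProductSpace
open MeasureTheory Set

noncomputable def Lagr {n m : ℕ} (f : EuclideanSpace ℝ (Fin n) → ℝ)
    (A : EuclideanSpace ℝ (Fin n) →L[ℝ] EuclideanSpace ℝ (Fin m))
    (b : EuclideanSpace ℝ (Fin m))
    (x : EuclideanSpace ℝ (Fin n)) (lam : EuclideanSpace ℝ (Fin m)) : ℝ :=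
  f x + ⟪lam, A x - b⟫

noncomputable def AugLagr {n m : ℕ} (f : EuclideanSpace ℝ (Fin n) → ℝ)
    (A : EuclideanSpace ℝ (Fin n) →L[ℝ] EuclideanSpace ℝ (Fin m))
    (b : EuclideanSpace ℝ (Fin m)) (σ : ℝ)
    (x : EuclideanSpace ℝ (Fin n)) (lam : EuclideanSpace ℝ (Fin m)) : ℝ :=
  Lagr f A b x lam + σ / 2 * ‖A x - b‖ ^ 2

def IsSaddlePoint {n m : ℕ} (f : EuclideanSpace ℝ (Fin n) → ℝ)
    (A : EuclideanSpace ℝ (Fin n) →L[ℝ] EuclideanSpace ℝ (Fin m))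
    (b : EuclideanSpace ℝ (Fin m))
    (xs : EuclideanSpace ℝ (Fin n)) (ls : EuclideanSpace ℝ (Fin m)) : Prop :=
  ∀ x lam, Lagr f A b xs lam ≤ Lagr f A b xs ls ∧ Lagr f A b xs ls ≤ Lagr f A b x ls

section InnerProduct

variable {E F : Type*} [NormedAddCommGroup E] [InnerProductSpace ℝ E] [CompleteSpace E]
  [NormedAddCommGroup F] [InnerProductSpace ℝ F] [CompleteSpace F]

theorem ConvexOn.add_inner_gradient_le {f : E → ℝ} (hf : ConvexOn ℝ univ f) {x : E}
    (hx : DifferentiableAt ℝ f x) (y : E) : f x + ⟪gradient f x, y - x⟫ ≤ f y := by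
  have hconv : ConvexOn ℝ univ (f ∘ AffineMap.lineMap (k := ℝ) x y) :=
    hf.comp_affineMap (AffineMap.lineMap x y)
  have hd : HasDerivAt (f ∘ AffineMap.lineMap (k := ℝ) x y) ⟪gradient f x, y - x⟫ 0 := by
    have h := hx.hasGradientAt.hasFDerivAt.comp_hasDerivAt_of_eq (0 : ℝ)
      (AffineMap.hasDerivAt_lineMap (a := x) (b := y)) (by simp)
    simpa using h
  have h := hconv.le_slope_of_hasDerivAt (mem_univ _) (mem_univ _) zero_lt_one hd
  simp only [slope_def_field, Function.comp_apply, AffineMap.lineMap_apply_one,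
    AffineMap.lineMap_apply_zero, sub_zero, div_one] at h
  linarith

/-- The derivative of the mixed energy `½‖y + δp‖²` along the primal equation, with `y` the
displacement, `p` the velocity and `l + ls` the multiplier. -/
theorem inner_velocity_identity (A : E →L[ℝ] F) (y p g : E) (l ls : F) (γ δ σ c : ℝ) :
    ⟪y + δ • p, p + δ • (-c • (g + A.adjoint (l + ls) + σ • A.adjoint (A y)) - γ • p)⟫ =
      -(γ * δ - 1) * (⟪y, p⟫ + δ * ‖p‖ ^ 2)
        - δ * c * (⟪g, y⟫ + ⟪ls, A y⟫ + σ * ‖A y‖ ^ 2)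
        - δ ^ 2 * c * (⟪g, p⟫ + ⟪ls, A p⟫ + σ * ⟪A y, A p⟫)
        - δ * ⟪l, c • (A y + δ • A p)⟫ := by
  simp only [← real_inner_self_eq_norm_sq, inner_add_left, inner_add_right, inner_sub_right,
    real_inner_smul_left, real_inner_smul_right, ContinuousLinearMap.adjoint_inner_right,
    map_add, map_smul]
  rw [real_inner_comm g y, real_inner_comm g p, real_inner_comm (A y) (A p),
    real_inner_comm ls (A y), real_inner_comm ls (A p), real_inner_comm l (A y),
    real_inner_comm l (A p)]
  ring

end InnerProduct

theorem constant_on_Ici_of_hasDerivWithinAt_zero {E : Type*} [NormedAddCommGroup E]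
    [NormedSpace ℝ E] {f : ℝ → E} {a : ℝ}
    (hf : ∀ t ∈ Ici a, HasDerivWithinAt f 0 (Ici a) t) {t : ℝ} (ht : t ∈ Ici a) : f t = f a :=
  constant_of_has_deriv_right_zero (b := t)
    (fun s hs => ((hf s hs.1).continuousWithinAt).mono Icc_subset_Ici_self)
    (fun s hs => (hf s hs.1).mono (Ici_subset_Ici.2 hs.1)) t (right_mem_Icc.2 ht)

theorem le_of_hasDerivWithinAt_Ici_nonpos {f f' : ℝ → ℝ} {a : ℝ}
    (hf : ∀ t ∈ Ici a, HasDerivWithinAt f (f' t) (Ici a) t) (hf' : ∀ t ∈ Ici a, f' t ≤ 0)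
    {t : ℝ} (ht : t ∈ Ici a) : f t ≤ f a :=
  antitoneOn_of_hasDerivWithinAt_nonpos (convex_Ici a)
    (fun s hs => (hf s hs).continuousWithinAt)
    (fun s hs => (hf s (interior_subset hs)).mono interior_subset)
    (fun s hs => hf' s (interior_subset hs)) self_mem_Ici ht ht

theorem IsSaddlePoint.map_eq {n m : ℕ} {f : EuclideanSpace ℝ (Fin n) → ℝ}
    {A : EuclideanSpace ℝ (Fin n) →L[ℝ] EuclideanSpace ℝ (Fin m)}
    {b : EuclideanSpace ℝ (Fin m)} {xs : EuclideanSpace ℝ (Fin n)}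
    {ls : EuclideanSpace ℝ (Fin m)} (h : IsSaddlePoint f A b xs ls) : A xs = b := by
  have h₁ := (h xs (ls + (A xs - b))).1
  simp only [Lagr, inner_add_left, real_inner_self_eq_norm_sq] at h₁
  have h₂ : ‖A xs - b‖ ^ 2 = 0 := le_antisymm (by linarith) (sq_nonneg _)
  exact sub_eq_zero.1 (norm_eq_zero.1 (pow_eq_zero_iff two_ne_zero |>.1 h₂))

theorem exponential_feasibility_rate
    {n m : ℕ}
    (f : EuclideanSpace ℝ (Fin n) → ℝ)
    (hf_conv : ConvexOn ℝ Set.univ f)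
    (hf_smooth : ContDiff ℝ 1 f)
    (A : EuclideanSpace ℝ (Fin n) →L[ℝ] EuclideanSpace ℝ (Fin m))
    (b : EuclideanSpace ℝ (Fin m))
    (t₀ γ δ σ : ℝ) (ht₀ : 0 ≤ t₀) (hγ : 0 < γ) (hδ : 0 < δ) (hσ : 0 < σ)
    (μ : ℝ) (hμ : 0 < μ) (hγδ : 1 < γ * δ)
    (β : ℝ → ℝ) (hβeq : ∀ t, β t = μ * Real.exp (t / δ))
    (xs : EuclideanSpace ℝ (Fin n)) (ls : EuclideanSpace ℝ (Fin m))
    (hsaddle : IsSaddlePoint f A b xs ls)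
    (x x' x'' : ℝ → EuclideanSpace ℝ (Fin n))
    (lam lam' : ℝ → EuclideanSpace ℝ (Fin m))
    (hx : ∀ t ∈ Ici t₀, HasDerivWithinAt x (x' t) (Ici t₀) t)
    (hx' : ∀ t ∈ Ici t₀, HasDerivWithinAt x' (x'' t) (Ici t₀) t)
    (hx''cont : ContinuousOn x'' (Ici t₀))
    (hlam : ∀ t ∈ Ici t₀, HasDerivWithinAt lam (lam' t) (Ici t₀) t)
    (hlam'cont : ContinuousOn lam' (Ici t₀))
    (hode1 : ∀ t ∈ Ici t₀, x'' t + γ • x' t =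
      -(β t) • (gradient f (x t) + A.adjoint (lam t) + σ • A.adjoint (A (x t) - b)))
    (hode2 : ∀ t ∈ Ici t₀, lam' t = β t • (A (x t + δ • x' t) - b))
    :
    ∃ C : ℝ, 0 ≤ C ∧ ∀ t ∈ Ici t₀, ‖A (x t) - b‖ ≤ C * Real.exp (-t / δ) := by
  obtain rfl := hsaddle.map_eq
  have hβpos : ∀ t, 0 < β t := fun t => by rw [hβeq]; positivity
  have hβ : ∀ t, HasDerivWithinAt β (β t / δ) (Ici t₀) t := fun t => by
    rw [funext hβeq]
    exact ((((hasDerivAt_id t).div_const δ).exp.const_mul μ).congr_deriv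
      (by simp; ring)).hasDerivWithinAt
  have hdiff : Differentiable ℝ f := hf_smooth.differentiable one_ne_zero
  have hy : ∀ t ∈ Ici t₀, HasDerivWithinAt (fun t => x t - xs) (x' t) (Ici t₀) t :=
    fun t ht => (hx t ht).sub_const xs
  have hr : ∀ t ∈ Ici t₀, HasDerivWithinAt (fun t => A (x t - xs)) (A (x' t)) (Ici t₀) t :=
    fun t ht => A.hasFDerivAt.comp_hasDerivWithinAt t (hy t ht)
  have hl : ∀ t ∈ Ici t₀, HasDerivWithinAt (fun t => lam t - ls) (lam' t) (Ici t₀) t :=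
    fun t ht => (hlam t ht).sub_const ls
  have hlam'_eq : ∀ t ∈ Ici t₀, lam' t = β t • (A (x t - xs) + δ • A (x' t)) := fun t ht => by
    rw [hode2 t ht]; simp only [map_add, map_smul, map_sub]; congr 1; abel
  -- The gap `L^σ(x(t), λ*) - L(x*, λ*)`.
  set gap : ℝ → ℝ := fun t =>
    f (x t) + ⟪ls, A (x t - xs)⟫ + σ / 2 * ‖A (x t - xs)‖ ^ 2 - f xs with hgap_def
  have hgap_nonneg : ∀ t, 0 ≤ gap t := fun t => by
    have h := (hsaddle (x t) ls).2
    simp only [Lagr, sub_self, inner_zero_right, ← map_sub] at h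
    have : 0 ≤ σ / 2 * ‖A (x t - xs)‖ ^ 2 := by positivity
    simp only [hgap_def]; linarith
  have hgap : ∀ t ∈ Ici t₀, HasDerivWithinAt gap
      (⟪gradient f (x t), x' t⟫ + ⟪ls, A (x' t)⟫ + σ * ⟪A (x t - xs), A (x' t)⟫)
      (Ici t₀) t := fun t ht => by
    have h₁ := (hdiff (x t)).hasGradientAt.hasFDerivAt.comp_hasDerivWithinAt t (hx t ht)
    have h₂ := (hasDerivWithinAt_const t (Ici t₀) ls).inner ℝ (hr t ht)
    have h₃ := (hr t ht).norm_sq.const_mul (σ / 2)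
    refine (((h₁.add h₂).add h₃).sub_const (f xs)).congr_deriv ?_
    simp; ring
  set V : ℝ → ℝ := fun t => δ ^ 2 * (β t * gap t) + 1 / 2 * ‖x t - xs + δ • x' t‖ ^ 2
    + (γ * δ - 1) / 2 * ‖x t - xs‖ ^ 2 + δ / 2 * ‖lam t - ls‖ ^ 2 with hV_def
  have hV : ∀ t ∈ Ici t₀, HasDerivWithinAt V
      (δ * β t * (gap t - (⟪gradient f (x t), x t - xs⟫ + ⟪ls, A (x t - xs)⟫
        + σ * ‖A (x t - xs)‖ ^ 2)) - (γ * δ - 1) * δ * ‖x' t‖ ^ 2) (Ici t₀) t := fun t ht => by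
    have h₁ := ((hβ t).mul (hgap t ht)).const_mul (δ ^ 2)
    have h₂ := ((hy t ht).add ((hx' t ht).const_smul δ)).norm_sq.const_mul (1 / 2 : ℝ)
    have h₃ := (hy t ht).norm_sq.const_mul ((γ * δ - 1) / 2)
    have h₄ := (hl t ht).norm_sq.const_mul (δ / 2)
    refine (((h₁.add h₂).add h₃).add h₄).congr_deriv ?_
    have key := inner_velocity_identity A (x t - xs) (x' t) (gradient f (x t)) (lam t - ls) ls
      γ δ σ (β t)
    have hx''_eq : x'' t = -β t • (gradient f (x t) + A.adjoint (lam t - ls + ls)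
        + σ • A.adjoint (A (x t - xs))) - γ • x' t := by
      rw [sub_add_cancel, map_sub, ← hode1 t ht, add_sub_cancel_right]
    rw [← hx''_eq, ← hlam'_eq t ht] at key
    simp only [Pi.add_apply, Pi.smul_apply]
    rw [key]
    field_simp
    ring
  have hV_le : ∀ t ∈ Ici t₀, V t ≤ V t₀ := fun t ht => by
    refine le_of_hasDerivWithinAt_Ici_nonpos hV (fun s _ => ?_) ht
    have h₁ := hf_conv.add_inner_gradient_le (hdiff (x s)) xs
    rw [← neg_sub (x s) xs, inner_neg_right] at h₁
    have h₂ : 0 ≤ σ * ‖A (x s - xs)‖ ^ 2 := by positivity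
    have h₃ : 0 ≤ (γ * δ - 1) * δ * ‖x' s‖ ^ 2 :=
      mul_nonneg (mul_nonneg (by linarith) hδ.le) (sq_nonneg _)
    have h₄ := mul_nonpos_of_nonneg_of_nonpos (mul_pos hδ (hβpos s)).le
      (show gap s - (⟪gradient f (x s), x s - xs⟫ + ⟪ls, A (x s - xs)⟫
        + σ * ‖A (x s - xs)‖ ^ 2) ≤ 0 by simp only [hgap_def]; linarith)
    linarith
  have hlam_bdd : ∀ t ∈ Ici t₀, ‖lam t - ls‖ ≤ √(2 / δ * V t₀) := fun t ht => by
    refine Real.le_sqrt_of_sq_le ?_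
    have h₁ : δ / 2 * ‖lam t - ls‖ ^ 2 ≤ V t := by
      have := hgap_nonneg t
      have := hβpos t
      have : 0 ≤ γ * δ - 1 := by linarith
      simp only [hV_def]
      exact le_add_of_nonneg_left (by positivity)
    calc ‖lam t - ls‖ ^ 2 = 2 / δ * (δ / 2 * ‖lam t - ls‖ ^ 2) := by field_simp
      _ ≤ 2 / δ * V t₀ := by gcongr; exact h₁.trans (hV_le t ht)
  -- `δ β (A x - b) - λ` is conserved.
  set w : ℝ → EuclideanSpace ℝ (Fin m) := fun t => δ • (β t • A (x t - xs)) - (lam t - ls)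
    with hw_def
  have hw : ∀ t ∈ Ici t₀, HasDerivWithinAt w 0 (Ici t₀) t := fun t ht => by
    refine ((((hβ t).smul (hr t ht)).const_smul δ).sub (hl t ht)).congr_deriv ?_
    rw [hlam'_eq t ht]
    have hδβ : δ * (β t / δ) = β t := mul_div_cancel₀ _ hδ.ne'
    simp only [smul_add, smul_smul, hδβ, mul_comm (β t) δ]
    abel
  refine ⟨(‖w t₀‖ + √(2 / δ * V t₀)) / (δ * μ), by positivity, fun t ht => ?_⟩
  have hbound : δ * β t * ‖A (x t - xs)‖ ≤ ‖w t₀‖ + √(2 / δ * V t₀) :=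
    calc δ * β t * ‖A (x t - xs)‖ = ‖w t + (lam t - ls)‖ := by
          rw [hw_def, sub_add_cancel, norm_smul, norm_smul, Real.norm_of_nonneg hδ.le,
            Real.norm_of_nonneg (hβpos t).le, mul_assoc]
      _ ≤ ‖w t₀‖ + √(2 / δ * V t₀) := by
          rw [constant_on_Ici_of_hasDerivWithinAt_zero hw ht]
          exact (norm_add_le _ _).trans (by gcongr; exact hlam_bdd t ht)
  rw [← map_sub, neg_div, Real.exp_neg, ← div_eq_mul_inv, div_div, le_div_iff₀ (by positivity)]
  rw [hβeq] at hbound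
  linarith
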